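/- arXiv:2402.11762 — 6 statements merged into one kernel-verified Lean document; each statement's English description precedes it below -/
import Mathlib

section
/- Let A be a real n×n matrix, b ∈ ℝⁿ, and let x : ℝ → ℝⁿ be a solution of the affine ordinary differential equation ẋ(t) = A x(t) + b for all t ≥ 0 such that the limit a = lim_{t → ∞} ẋ(t) exists. Then a lies in the kernel of A, and a − b lies in the range of A; consequently there exists a vector c ∈ ℝⁿ with a = A c + b, so that t ↦ t a + c is a straight-line solution of the equation. -/
open Filter Matrix

/-- If `x` solves `ẋ = A x + b` on `[0, ∞)` and `ẋ(t)` converges to `a`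
as `t → ∞`, then `a ∈ ker A` and `a - b ∈ range A`; consequently there is `c` with
`a = A c + b`, so that `t ↦ t a + c` is a straight-line solution of the equation. -/
theorem limit_of_derivative_in_kernel
    (n : ℕ) (A : Matrix (Fin n) (Fin n) ℝ) (b : Fin n → ℝ)
    (x : ℝ → Fin n → ℝ) (a : Fin n → ℝ)
    (hsol : ∀ t ∈ Set.Ici (0:ℝ), HasDerivAt x (A.mulVec (x t) + b) t)
    (hlim : Tendsto (fun t => A.mulVec (x t) + b) atTop (nhds a)) :
    A.mulVec a = 0 ∧ (a - b) ∈ LinearMap.range A.mulVecLin ∧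
      ∃ c : Fin n → ℝ, a = A.mulVec c + b ∧
        ∀ t : ℝ, HasDerivAt (fun s : ℝ => s • a + c) (A.mulVec (t • a + c) + b) t := by
  have hcont : Continuous (fun v : Fin n → ℝ => A.mulVec v) :=
    A.mulVecLin.continuous_of_finiteDimensional
  have hker : A.mulVec a = 0 := by
    funext i
    have hy : ∀ t ∈ Set.Ici (0:ℝ), HasDerivAt (fun s => (A.mulVec (x s) + b) i)
        ((A.mulVec (A.mulVec (x t) + b)) i) t := by
      intro t ht
      have h1 := (LinearMap.toContinuousLinearMap A.mulVecLin).hasFDerivAt.comp_hasDerivAt t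
        (hsol t ht)
      have h2 := (hasDerivAt_pi.1 h1 i).add_const (b i)
      exact h2
    have hmvt : ∀ k : ℕ, ∃ ξ ∈ Set.Ioo (k:ℝ) (k+1),
        (A.mulVec (A.mulVec (x ξ) + b)) i
          = (A.mulVec (x ((k:ℝ)+1)) + b) i - (A.mulVec (x (k:ℝ)) + b) i := by
      intro k
      have hk : (0:ℝ) ≤ k := k.cast_nonneg
      obtain ⟨ξ, hξ, h⟩ := exists_hasDerivAt_eq_slope (fun s => (A.mulVec (x s) + b) i)
        (fun t => (A.mulVec (A.mulVec (x t) + b)) i) (lt_add_one (k:ℝ))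
        (fun t ht => (hy t (hk.trans ht.1)).continuousAt.continuousWithinAt)
        (fun t ht => hy t (hk.trans ht.1.le))
      refine ⟨ξ, hξ, ?_⟩
      simpa using h
    choose ξ hξ h using hmvt
    have hk : Tendsto (fun k : ℕ => (k:ℝ)) atTop atTop := tendsto_natCast_atTop_atTop
    have hξt : Tendsto ξ atTop atTop := tendsto_atTop_mono (fun k => (hξ k).1.le) hk
    have hi := (tendsto_pi_nhds.1 hlim) i
    have hL := (tendsto_pi_nhds.1 ((hcont.tendsto a).comp (hlim.comp hξt))) i
    have hR := (hi.comp (tendsto_atTop_add_const_right _ (1:ℝ) hk)).sub (hi.comp hk)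
    have := tendsto_nhds_unique (hL.congr h) hR
    simpa using this
  have hran : (a - b) ∈ LinearMap.range A.mulVecLin := by
    have hc : IsClosed (LinearMap.range A.mulVecLin : Set (Fin n → ℝ)) :=
      Submodule.closed_of_finiteDimensional _
    refine hc.mem_of_tendsto (hlim.sub_const b) (Eventually.of_forall fun t => ?_)
    exact ⟨x t, by simp⟩
  refine ⟨hker, hran, ?_⟩
  obtain ⟨c, hc⟩ := hran
  have hac : a = A.mulVec c + b := by
    rw [Matrix.mulVecLin_apply] at hc
    rw [hc, sub_add_cancel]
  refine ⟨c, hac, fun t => ?_⟩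
  have : A.mulVec (t • a + c) + b = a := by
    rw [Matrix.mulVec_add, Matrix.mulVec_smul, hker, smul_zero, zero_add, ← hac]
  rw [this]
  simpa using ((hasDerivAt_id t).smul_const a).add_const c
end

section
/- Let A be a real n×n matrix with ker A ∩ im A = {0} and dim ker A = 1, and let b ∈ ℝⁿ with b ∉ im A. Then the non-constant straight-line solution of ẋ = A x + b is unique up to time translation: if t ↦ t a + c and t ↦ t a′ + c′ are both straight-line solutions with nonzero rates, then a′ = a and c′ = c + k a for some real number k. In particular, the rate of the non-constant straight-line solution is uniquely determined. -/
open Matrix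

/-- `t ↦ t • a + c` is a (straight-line) solution of the affine ODE `ẋ = A x + b`. -/
def IsStraightLineSolution {n : ℕ} (A : Matrix (Fin n) (Fin n) ℝ) (b a c : Fin n → ℝ) : Prop :=
  ∀ t : ℝ, HasDerivAt (fun s : ℝ => s • a + c) (A.mulVec (t • a + c) + b) t

lemma IsStraightLineSolution.eqs {n : ℕ} {A : Matrix (Fin n) (Fin n) ℝ} {b a c : Fin n → ℝ}
    (h : IsStraightLineSolution A b a c) : A.mulVec a = 0 ∧ a = A.mulVec c + b := by
  have key : ∀ t : ℝ, A.mulVec (t • a + c) + b = a := by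
    intro t
    have h1 : HasDerivAt (fun s : ℝ => s • a + c) a t := by
      simpa using ((hasDerivAt_id t).smul_const a).add_const c
    exact (h t).unique h1
  have h0 := key 0
  have h1 := key 1
  rw [zero_smul, zero_add] at h0
  rw [one_smul, Matrix.mulVec_add, add_assoc, h0] at h1
  exact ⟨by simpa using h1, h0.symm⟩

/-- If `ker A ∩ im A = {0}`, `dim ker A = 1` and `b ∉ im A`, then the
non-constant straight-line solution of `ẋ = A x + b` is unique up to time translation:
any two straight-line solutions with nonzero rates have the same rate `a`, and their
constant parts differ by a multiple of `a`. In particular the rate is unique. -/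
theorem nonconstant_straight_line_solution_unique
    (n : ℕ) (A : Matrix (Fin n) (Fin n) ℝ) (b : Fin n → ℝ)
    (hker : LinearMap.ker A.mulVecLin ⊓ LinearMap.range A.mulVecLin = ⊥)
    (hdim : Module.finrank ℝ (LinearMap.ker A.mulVecLin) = 1)
    (hb : b ∉ LinearMap.range A.mulVecLin) :
    ∀ a c a' c' : Fin n → ℝ, a ≠ 0 → a' ≠ 0 →
      IsStraightLineSolution A b a c → IsStraightLineSolution A b a' c' →
        a' = a ∧ ∃ k : ℝ, c' = c + k • a := by
  intro a c a' c' ha _ h h'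
  obtain ⟨hA, hc⟩ := h.eqs
  obtain ⟨hA', hc'⟩ := h'.eqs
  have haa : a' = a := by
    have hm : a' - a ∈ LinearMap.ker A.mulVecLin ⊓ LinearMap.range A.mulVecLin := by
      refine ⟨?_, c' - c, ?_⟩
      · simp [Matrix.mulVec_sub, hA, hA']
      · rw [Matrix.mulVecLin_apply, Matrix.mulVec_sub]
        conv_rhs => rw [hc, hc']
        abel
    rw [hker, Submodule.mem_bot] at hm
    exact sub_eq_zero.mp hm
  refine ⟨haa, ?_⟩
  have hcc : c' - c ∈ LinearMap.ker A.mulVecLin := by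
    rw [LinearMap.mem_ker, Matrix.mulVecLin_apply, Matrix.mulVec_sub, sub_eq_zero]
    have h2 : A.mulVec c' + b = A.mulVec c + b := by rw [← hc, ← hc', haa]
    exact add_right_cancel h2
  have hak : a ∈ LinearMap.ker A.mulVecLin := by simpa using hA
  obtain ⟨k, hk⟩ := (finrank_eq_one_iff_of_nonzero' (⟨a, hak⟩ : LinearMap.ker A.mulVecLin)
    (by simpa [Subtype.ext_iff] using ha)).mp hdim ⟨c' - c, hcc⟩
  refine ⟨k, ?_⟩
  have hk' : k • a = c' - c := congrArg Subtype.val hk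
  rw [hk']
  abel
end

section
/- Let A be a real n×n matrix such that 0 is an eigenvalue of algebraic multiplicity one and every nonzero eigenvalue of A has negative real part, and let b ∈ ℝⁿ with b ∉ im A. Then the equation ẋ = A x + b has a non-constant straight-line solution with rate a, and every solution x of ẋ = A x + b satisfies lim_{t → ∞} ‖ẋ(t) − a‖ = 0. -/
open Matrix Filter

/-- A matrix may be applied to a derivative. -/
lemma hasDerivAt_mulVec_aux {n : ℕ} (N : Matrix (Fin n) (Fin n) ℂ) (z : ℝ → Fin n → ℂ)
    (z' : Fin n → ℂ) (t : ℝ) (h : HasDerivAt z z' t) :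
    HasDerivAt (fun s => N *ᵥ z s) (N *ᵥ z') t := by
  have := ((LinearMap.toContinuousLinearMap N.mulVecLin).restrictScalars ℝ).hasFDerivAt
    (x := z t) |>.comp_hasDerivAt t h
  exact this

/-- Decay for `z' = μ z + w` with exponentially decaying `w`. -/
lemma decay_step_aux {n : ℕ} (μ : ℂ) (hμ : μ.re < 0) (z w : ℝ → Fin n → ℂ)
    (hz : ∀ t, HasDerivAt z (μ • z t + w t) t)
    (hw : ∃ δ > 0, ∃ C : ℝ, ∀ t : ℝ, 0 ≤ t → ‖w t‖ ≤ C * Real.exp (-δ * t)) :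
    ∃ δ > 0, ∃ C : ℝ, ∀ t : ℝ, 0 ≤ t → ‖z t‖ ≤ C * Real.exp (-δ * t) := by
  obtain ⟨δ₀, hδ₀, C, hC⟩ := hw
  have hC0 : 0 ≤ C := by
    have := (norm_nonneg _).trans (hC 0 le_rfl)
    simpa using this
  obtain ⟨δ, hδ, hδ1, hδ2⟩ : ∃ δ > 0, δ ≤ δ₀ ∧ δ < -μ.re :=
    ⟨min δ₀ (-μ.re / 2), lt_min hδ₀ (by linarith), min_le_left _ _,
      (min_le_right _ _).trans_lt (by linarith)⟩
  have hC' : ∀ t : ℝ, 0 ≤ t → ‖w t‖ ≤ C * Real.exp (-δ * t) := fun t ht =>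
    (hC t ht).trans (mul_le_mul_of_nonneg_left (Real.exp_le_exp.2 (by nlinarith)) hC0)
  set r := -μ.re - δ with hr
  have hr0 : 0 < r := by linarith
  set K := max (C / r) ‖z 0‖ with hK
  have hKC : C ≤ K * r := by
    rw [← div_le_iff₀ hr0]; exact le_max_left _ _
  have hnorm : ∀ t : ℝ, ‖Complex.exp (-μ * t)‖ = Real.exp (-μ.re * t) := by
    intro t
    rw [Complex.norm_exp]; simp
  have hexp : ∀ t : ℝ, HasDerivAt (fun s : ℝ => Complex.exp (-μ * s))
      (Complex.exp (-μ * t) * (-μ)) t := by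
    intro t
    have h1 : HasDerivAt (fun s : ℝ => -μ * (s : ℂ)) (-μ) t := by
      simpa using (Complex.ofRealCLM.hasDerivAt (x := t)).const_mul (-μ)
    exact h1.cexp
  have hu : ∀ t : ℝ, HasDerivAt (fun s : ℝ => Complex.exp (-μ * s) • z s)
      (Complex.exp (-μ * t) • w t) t := by
    intro t
    have h1 : Complex.exp (-μ * t) • w t = Complex.exp (-μ * t) • (μ • z t + w t)
        + (Complex.exp (-μ * t) * (-μ)) • z t := by
      rw [smul_add, smul_smul, mul_neg, neg_smul]
      abel
    rw [h1]
    exact (hexp t).smul (hz t)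
  have hB : ∀ t : ℝ, HasDerivAt (fun s : ℝ => K * Real.exp (r * s))
      (K * (Real.exp (r * t) * r)) t := by
    intro t
    have h1 : HasDerivAt (fun s : ℝ => r * s) r t := by
      simpa using (hasDerivAt_id t).const_mul r
    exact h1.exp.const_mul K
  refine ⟨δ, hδ, K, fun t ht => ?_⟩
  have key := image_norm_le_of_norm_deriv_right_le_deriv_boundary
    (f := fun s : ℝ => Complex.exp (-μ * s) • z s) (f' := fun t => Complex.exp (-μ * t) • w t)
    (a := 0) (b := t)
    (fun s _ => (hu s).continuousAt.continuousWithinAt)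
    (fun s _ => (hu s).hasDerivWithinAt)
    (B := fun s : ℝ => K * Real.exp (r * s)) (B' := fun t => K * (Real.exp (r * t) * r))
    (by simp [hK]) hB ?_ (x := t) ⟨ht, le_rfl⟩
  · rw [norm_smul, hnorm] at key
    have h2 : Real.exp (-μ.re * t) * (K * Real.exp (-δ * t)) = K * Real.exp (r * t) := by
      rw [mul_left_comm, ← Real.exp_add]; congr 2; rw [hr]; ring
    rw [← h2] at key
    exact le_of_mul_le_mul_left key (Real.exp_pos _)
  · intro s hs
    rw [norm_smul, hnorm]
    calc Real.exp (-μ.re * s) * ‖w s‖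
        ≤ Real.exp (-μ.re * s) * (C * Real.exp (-δ * s)) :=
          mul_le_mul_of_nonneg_left (hC' s hs.1) (Real.exp_pos _).le
      _ = C * Real.exp (r * s) := by
          rw [mul_left_comm, ← Real.exp_add]; congr 2; rw [hr]; ring
      _ ≤ (K * r) * Real.exp (r * s) :=
          mul_le_mul_of_nonneg_right hKC (Real.exp_pos _).le
      _ = K * (Real.exp (r * s) * r) := by ring

open Polynomial in
/-- Solutions of `z' = M z` killed by a Hurwitz polynomial in `M` decay exponentially. -/
lemma decay_aux {n : ℕ} (M : Matrix (Fin n) (Fin n) ℂ) (s : Multiset ℂ) :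
    (∀ μ ∈ s, μ.re < 0) → ∀ z : ℝ → Fin n → ℂ, (∀ t, HasDerivAt z (M *ᵥ z t) t) →
    (∀ t, (aeval M (s.map (fun μ => X - C μ)).prod) *ᵥ z t = 0) →
    ∃ δ > 0, ∃ C : ℝ, ∀ t : ℝ, 0 ≤ t → ‖z t‖ ≤ C * Real.exp (-δ * t) := by
  induction s using Multiset.induction with
  | empty =>
    intro _ z _ h
    refine ⟨1, one_pos, 0, fun t _ => ?_⟩
    have := h t
    simp at this
    simp [this]
  | cons μ s ih =>
    intro hs z hz h
    have hN : ∀ v : Fin n → ℂ, (aeval M (X - C μ)) *ᵥ v = M *ᵥ v - μ • v := by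
      intro v
      simp [Matrix.sub_mulVec, Algebra.algebraMap_eq_smul_one, Matrix.smul_mulVec]
    have hw := ih (fun ν hν => hs ν (Multiset.mem_cons_of_mem hν))
      (fun t => (aeval M (X - C μ)) *ᵥ z t) (fun t => by
        have := hasDerivAt_mulVec_aux (aeval M (X - C μ)) z _ t (hz t)
        convert this using 1
        rw [hN, hN, Matrix.mulVec_sub, Matrix.mulVec_smul])
      (fun t => by
        have := h t
        rw [Multiset.map_cons, Multiset.prod_cons, mul_comm, map_mul, ← Matrix.mulVec_mulVec] at this
        exact this)
    refine decay_step_aux μ (hs μ (Multiset.mem_cons_self _ _)) z _ (fun t => ?_) hw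
    convert hz t using 1
    rw [hN]; abel

/-- Suppose `0` is an eigenvalue of `A` of algebraic multiplicity one, every
nonzero complex eigenvalue of `A` has negative real part, and `b ∉ im A`. Then `ẋ = A x + b`
has a non-constant straight-line solution with rate `a`, and every solution `x` satisfies
`‖ẋ(t) − a‖ → 0` as `t → ∞`. -/
theorem derivative_converges_to_rate
    (n : ℕ) (A : Matrix (Fin n) (Fin n) ℝ) (b : Fin n → ℝ)
    (hmult : Polynomial.rootMultiplicity 0 A.charpoly = 1)
    (heig : ∀ μ : ℂ, μ ≠ 0 → Polynomial.aeval μ A.charpoly = 0 → μ.re < 0)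
    (hb : b ∉ LinearMap.range A.mulVecLin) :
    ∃ a c : Fin n → ℝ, a ≠ 0 ∧ IsStraightLineSolution A b a c ∧
      ∀ x : ℝ → Fin n → ℝ, (∀ t : ℝ, HasDerivAt x (A.mulVec (x t) + b) t) →
        Tendsto (fun t : ℝ => ‖(A.mulVec (x t) + b) - a‖) atTop (nhds 0) := by
  classical
  have hp0 : A.charpoly ≠ 0 := A.charpoly_monic.ne_zero
  obtain ⟨q, hq, hq0⟩ := Polynomial.exists_eq_pow_rootMultiplicity_mul_and_not_dvd
    A.charpoly hp0 0
  rw [hmult, pow_one, Polynomial.C_0, sub_zero] at hq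
  rw [Polynomial.C_0, sub_zero, Polynomial.X_dvd_iff] at hq0
  set q0 := q.coeff 0 with hq0def
  have hqA : Polynomial.aeval A q = A * Polynomial.aeval A q.divX + q0 • 1 := by
    conv_lhs => rw [← Polynomial.X_mul_divX_add q]
    rw [map_add, map_mul, Polynomial.aeval_X, Polynomial.aeval_C, Algebra.algebraMap_eq_smul_one]
  have hAq : A * Polynomial.aeval A q = 0 := by
    have := A.aeval_self_charpoly
    rw [hq] at this
    simpa using this
  set a := q0⁻¹ • (Polynomial.aeval A q *ᵥ b) with ha
  set c := q0⁻¹ • (Polynomial.aeval A q.divX *ᵥ b) with hc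
  have hAa : A *ᵥ a = 0 := by
    rw [ha, Matrix.mulVec_smul, Matrix.mulVec_mulVec, hAq]; simp
  have hac : A *ᵥ c + b = a := by
    rw [ha, hc, hqA, Matrix.add_mulVec, Matrix.mulVec_smul, Matrix.mulVec_mulVec, smul_add,
      Matrix.smul_mulVec, Matrix.one_mulVec, smul_smul, inv_mul_cancel₀ hq0, one_smul]
  refine ⟨a, c, ?_, ?_, ?_⟩
  · intro h
    apply hb
    refine ⟨-c, ?_⟩
    rw [Matrix.mulVecLin_apply, Matrix.mulVec_neg]
    rw [h] at hac
    exact neg_eq_of_add_eq_zero_right hac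
  · intro t
    rw [Matrix.mulVec_add, Matrix.mulVec_smul, hAa, smul_zero, zero_add, hac]
    simpa using ((hasDerivAt_id t).smul_const a).add_const c
  · intro x hx
    set M : Matrix (Fin n) (Fin n) ℂ := A.map Complex.ofRealHom with hM
    have hmap : ∀ v : Fin n → ℝ, (fun i => ((A *ᵥ v) i : ℂ)) = M *ᵥ (fun i => (v i : ℂ)) := by
      intro v
      ext i
      simp [Matrix.mulVec, dotProduct, hM]
    have hz0 : ∀ t, A *ᵥ (x t) + b - a = A *ᵥ (x t - c) := by
      intro t
      rw [Matrix.mulVec_sub, ← hac]; abel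
    set z : ℝ → Fin n → ℂ := fun t => M *ᵥ (fun i => ((x t - c) i : ℂ)) with hz
    have hzA : ∀ t, z t = fun i => ((A *ᵥ (x t - c)) i : ℂ) := fun t => (hmap _).symm
    have hzd : ∀ t, HasDerivAt z (M *ᵥ z t) t := by
      intro t
      have h0 : A *ᵥ (A *ᵥ x t + b) = A *ᵥ (A *ᵥ (x t - c)) := by
        rw [← hz0, Matrix.mulVec_sub, hAa, sub_zero]
      rw [hzA, ← hmap, ← h0, hmap]
      apply hasDerivAt_mulVec_aux
      rw [hasDerivAt_pi]
      intro i
      have h1 := (hasDerivAt_pi.1 ((hx t).sub_const c)) i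
      exact h1.ofReal_comp
    set Q := q.map Complex.ofRealHom with hQ
    have hMC : M.charpoly = Polynomial.X * Q := by
      rw [hM, Matrix.charpoly_map, hq, Polynomial.map_mul, Polynomial.map_X]
    have hMQ : Polynomial.aeval M Q * M = 0 := by
      have := M.aeval_self_charpoly
      rw [hMC, mul_comm] at this
      simpa using this
    have hQne : Q ≠ 0 := by
      intro h
      have := M.charpoly_monic.ne_zero
      rw [hMC, h] at this
      simp at this
    have hroots : ∀ μ ∈ Q.roots, μ.re < 0 := by
      intro μ hμ
      have hμ' : Q.eval μ = 0 := (Polynomial.mem_roots hQne).1 hμ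
      apply heig μ
      · rintro rfl
        rw [← Polynomial.coeff_zero_eq_eval_zero, hQ, Polynomial.coeff_map] at hμ'
        exact hq0 (by simpa using hμ')
      · rw [hq, map_mul]
        have : Polynomial.aeval μ q = 0 := by
          rw [Polynomial.aeval_def, ← Polynomial.eval_map]
          exact hμ'
        rw [this, mul_zero]
    have hprod := (IsAlgClosed.splits Q).eq_prod_roots
    have hkill : ∀ t, (Polynomial.aeval M
        (Q.roots.map (fun μ => Polynomial.X - Polynomial.C μ)).prod) *ᵥ z t = 0 := by
      intro t
      have h1 : Polynomial.aeval M Q *ᵥ z t = 0 := by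
        rw [hz]; simp only [Matrix.mulVec_mulVec, hMQ, Matrix.zero_mulVec]
      rw [hprod, map_mul, Polynomial.aeval_C, Algebra.algebraMap_eq_smul_one, smul_mul_assoc, one_mul,
        Matrix.smul_mulVec] at h1
      exact (smul_eq_zero.1 h1).resolve_left (by simpa using hQne)
    obtain ⟨δ, hδ, C, hC⟩ := decay_aux M Q.roots hroots z hzd hkill
    have hlim : Tendsto (fun t : ℝ => C * Real.exp (-δ * t)) atTop (nhds 0) := by
      have : Tendsto (fun t : ℝ => -δ * t) atTop atBot :=
        tendsto_id.const_mul_atTop_of_neg (by linarith)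
      simpa using (Real.tendsto_exp_atBot.comp this).const_mul C
    refine squeeze_zero' (Eventually.of_forall fun t => norm_nonneg _) ?_ hlim
    filter_upwards [eventually_ge_atTop 0] with t ht
    refine le_trans ?_ (hC t ht)
    rw [hz0, hzA]
    refine (pi_norm_le_iff_of_nonneg (norm_nonneg _)).2 fun i => ?_
    have := norm_le_pi_norm (fun i => ((A *ᵥ (x t - c)) i : ℂ)) i
    simpa using this
end

section
/- Let A be a real n×n matrix whose characteristic polynomial p has 0 as a root of multiplicity one, and suppose all other (complex) eigenvalues of A have negative real parts. Then for every b ∈ ℝⁿ, every solution x of ẋ = A x + b satisfies lim_{t → ∞} ẋ(t) = (1/p′(0)) · adj(−A) b, where p′ is the derivative of the characteristic polynomial and adj(−A) is the adjugate matrix of −A. -/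
open Matrix Filter

open Polynomial in
/-- The adjugate of `-A` is `q(A)` where `p = X q`. -/
lemma adjugate_neg_eq {n : ℕ} (A : Matrix (Fin n) (Fin n) ℝ) (q : Polynomial ℝ)
    (hq : A.charpoly = X * q) : Matrix.adjugate (-A) = aeval A q := by
  let y : Matrix (Fin n) (Fin n) ℝ[X] := (C : ℝ →+* ℝ[X]).mapMatrix A
  let qq : ℝ[X][X] := q.map C
  have hqeval : qq.eval X = q := by
    simp only [qq]
    rw [eval_map]
    exact Polynomial.eval₂_C_X
  have hy : ∀ f : ℝ[X], aeval y (f.map (C : ℝ →+* ℝ[X])) =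
      (C : ℝ →+* ℝ[X]).mapMatrix (aeval A f) := by
    intro f
    induction f using Polynomial.induction_on' with
    | add f g hf hg => simp only [Polynomial.map_add, map_add, hf, hg]
    | monomial k a =>
      simp only [map_monomial, aeval_monomial, y, map_mul, map_pow]
      congr 1
      ext i j
      by_cases h : i = j <;> simp [algebraMap_matrix_apply, h]
  obtain ⟨R, hR⟩ := X_sub_C_dvd_sub_C_eval (p := qq) (a := (X : ℝ[X]))
  rw [hqeval] at hR
  have hR2 := congrArg (aeval y) hR
  have hchar : charmatrix A = algebraMap ℝ[X] _ X - y := by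
    ext1 i j
    by_cases h : i = j
    · subst h; simp [charmatrix, y, algebraMap_matrix_apply]
    · simp [charmatrix, y, algebraMap_matrix_apply, h]
  have hCH : y * (C : ℝ →+* ℝ[X]).mapMatrix (aeval A q) = 0 := by
    have := Matrix.aeval_self_charpoly A
    rw [hq, map_mul, aeval_X] at this
    simp only [y]
    rw [← map_mul, this, map_zero]
  simp only [map_sub, map_mul, aeval_X, aeval_C, qq, hy] at hR2
  set x : Matrix (Fin n) (Fin n) ℝ[X] := algebraMap ℝ[X] _ X with hx
  set Q := (C : ℝ →+* ℝ[X]).mapMatrix (aeval A q) with hQ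
  have hcomm : x * y = y * x := Algebra.commutes _ _
  have hN : charmatrix A * (x * aeval y R + Q) = A.charpoly • (1 : Matrix (Fin n) (Fin n) ℝ[X]) := by
    rw [hq, ← Algebra.algebraMap_eq_smul_one, map_mul, ← hx, hchar]
    have h1 : algebraMap ℝ[X] (Matrix (Fin n) (Fin n) ℝ[X]) q = Q - (y - x) * aeval y R := by
      rw [← hR2]; abel
    rw [h1]
    have e1 : (x - y) * (x * aeval y R + Q)
        = x * (x * aeval y R) - y * x * aeval y R + x * Q - y * Q := by noncomm_ring
    have e2 : x * (Q - (y - x) * aeval y R) = x * Q - x * y * aeval y R + x * (x * aeval y R) := by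
      noncomm_ring
    rw [e1, e2, hCH, hcomm]; abel
  have hadj : adjugate (charmatrix A) = x * aeval y R + Q := by
    have h2 : A.charpoly • (x * aeval y R + Q) = A.charpoly • adjugate (charmatrix A) := by
      have h3 := congrArg (fun M => adjugate (charmatrix A) * M) hN
      simp only [← Matrix.mul_assoc, adjugate_mul] at h3
      simpa [Matrix.charpoly] using h3
    exact (smul_right_injective _ (Matrix.charpoly_monic A).ne_zero h2).symm
  have h4 := congrArg ((evalRingHom (0 : ℝ)).mapMatrix) hadj
  rw [RingHom.map_adjugate] at h4
  have h5 : (evalRingHom (0 : ℝ)).mapMatrix (charmatrix A) = -A := by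
    ext i j
    by_cases h : i = j
    · subst h; simp [charmatrix]
    · simp [charmatrix, h]
  have h6 : (evalRingHom (0 : ℝ)).mapMatrix x = 0 := by
    ext i j
    by_cases h : i = j <;> simp [hx, algebraMap_matrix_apply, h]
  rw [h5, map_add, map_mul, h6, zero_mul, zero_add] at h4
  rw [h4]
  ext i j
  simp [hQ]

/-- Scalar-type linear ODE with decaying forcing. -/
lemma decay_aux_s8 {E : Type*} [NormedAddCommGroup E] [NormedSpace ℂ E] (μ : ℂ) (hμ : μ.re < 0)
    (w u : ℝ → E) (hw : ∀ t, HasDerivAt w (μ • w t + u t) t)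
    (hu : Tendsto u atTop (nhds 0)) : Tendsto w atTop (nhds 0) := by
  set c := -μ.re with hc
  have hcpos : 0 < c := by linarith
  let z : ℝ → E := fun t => Complex.exp (-μ * t) • w t
  have hnorm : ∀ t : ℝ, ‖Complex.exp (-μ * t)‖ = Real.exp (c * t) := by
    intro t
    rw [Complex.norm_exp]; simp [hc]
  have hz : ∀ t : ℝ, HasDerivAt z (Complex.exp (-μ * t) • u t) t := by
    intro t
    have h1 : HasDerivAt (fun t : ℝ => Complex.exp (-μ * t)) (Complex.exp (-μ * t) * (-μ * 1)) t :=
      (((hasDerivAt_id (t : ℂ)).const_mul (-μ)).cexp).comp_ofReal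
    have h2 := h1.smul (hw t)
    convert h2 using 1
    · rfl
    simp only [smul_add, smul_smul]
    rw [add_right_comm, ← add_smul]
    simp
  have hzn : ∀ t, ‖z t‖ = Real.exp (c * t) * ‖w t‖ := by
    intro t; simp only [z]; rw [norm_smul, hnorm]
  rw [Metric.tendsto_atTop]
  intro ε hε
  obtain ⟨T, hT⟩ := (Metric.tendsto_atTop.1 hu) (c * (ε / 2)) (by positivity)
  have hbound : ∀ t, T ≤ t → ‖w t‖ ≤ Real.exp (-c * t) * ‖z T‖ + ε / 2 := by
    intro t ht
    let B : ℝ → ℝ := fun s => ‖z T‖ + ε / 2 * (Real.exp (c * s) - Real.exp (c * T))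
    have hB : ∀ s, HasDerivAt B (ε / 2 * (Real.exp (c * s) * (c * 1))) s := by
      intro s
      exact (((((hasDerivAt_id s).const_mul c).exp).sub_const _).const_mul _).const_add _
    have := image_norm_le_of_norm_deriv_right_le_deriv_boundary (a := T) (b := t)
      (f := z) (f' := fun s => Complex.exp (-μ * s) • u s)
      (fun s _ => (hz s).continuousAt.continuousWithinAt)
      (fun s _ => (hz s).hasDerivWithinAt) (B := B) (by simp [B]) hB
      (by
        intro s hs
        rw [norm_smul, hnorm]
        have h := (hT s hs.1).le
        rw [dist_zero_right] at h
        have := mul_le_mul_of_nonneg_left h (Real.exp_pos (c * s)).le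
        linarith) (Set.right_mem_Icc.2 ht)
    rw [hzn] at this
    have h3 := mul_le_mul_of_nonneg_left this (Real.exp_pos (-c * t)).le
    have h4 : Real.exp (-c * t) * Real.exp (c * t) = 1 := by
      rw [← Real.exp_add]; simp
    rw [← mul_assoc, h4, one_mul] at h3
    refine h3.trans ?_
    have h5 : 0 ≤ Real.exp (-c * t) * (ε / 2 * Real.exp (c * T)) := by positivity
    have h6 : Real.exp (-c * t) * B t = Real.exp (-c * t) * ‖z T‖
      + ε / 2 * (Real.exp (-c * t) * Real.exp (c * t))
      - Real.exp (-c * t) * (ε / 2 * Real.exp (c * T)) := by simp only [B]; ring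
    rw [h6, h4]; linarith
  have hlim : Tendsto (fun t : ℝ => Real.exp (-c * t) * ‖z T‖) atTop (nhds 0) := by
    have h1 : Tendsto (fun t : ℝ => -c * t) atTop atBot :=
      tendsto_id.const_mul_atTop_of_neg (by linarith)
    simpa using (Real.tendsto_exp_atBot.comp h1).mul_const ‖z T‖
  obtain ⟨T2, hT2⟩ := eventually_atTop.1 (hlim.eventually (gt_mem_nhds (half_pos hε)))
  refine ⟨max T T2, fun t ht => ?_⟩
  rw [dist_zero_right]
  have := hbound t (le_of_max_le_left ht)
  have := hT2 t (le_of_max_le_right ht)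
  linarith

lemma hasDerivAt_mulVec' {𝕜 : Type*} [RCLike 𝕜] {n : ℕ} (M : Matrix (Fin n) (Fin n) 𝕜)
    (w : ℝ → Fin n → 𝕜) (w' : Fin n → 𝕜) (t : ℝ) (h : HasDerivAt w w' t) :
    HasDerivAt (fun s => M *ᵥ w s) (M *ᵥ w') t := by
  rw [hasDerivAt_pi] at h ⊢
  intro i
  simp only [Matrix.mulVec, dotProduct]
  exact HasDerivAt.fun_sum fun j _ => (h j).const_mul (M i j)

open Polynomial in
lemma decay_roots {n : ℕ} (B : Matrix (Fin n) (Fin n) ℂ) (s : Multiset ℂ) :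
    (∀ μ ∈ s, μ.re < 0) → ∀ w : ℝ → Fin n → ℂ, (∀ t, HasDerivAt w (B *ᵥ w t) t) →
    (∀ t, aeval B (s.map (fun a => X - C a)).prod *ᵥ w t = 0) → Tendsto w atTop (nhds 0) := by
  induction s using Multiset.induction_on with
  | empty =>
    intro _ w _ h
    have : w = fun _ => 0 := by funext t; simpa using h t
    rw [this]; exact tendsto_const_nhds
  | cons μ s ih =>
    intro hs w hw h
    let M : Matrix (Fin n) (Fin n) ℂ := aeval B (X - C μ)
    have hMB : M * B = B * M := by
      have := congrArg (aeval B) (mul_comm (X - C μ) (X : ℂ[X]))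
      simpa only [map_mul, aeval_X] using this
    have hMw : ∀ v : Fin n → ℂ, M *ᵥ v = B *ᵥ v - μ • v := by
      intro v
      simp [M, Matrix.sub_mulVec, Algebra.algebraMap_eq_smul_one, Matrix.smul_mulVec]
    have hu := ih (fun a ha => hs a (Multiset.mem_cons_of_mem ha)) (fun t => M *ᵥ w t)
      (by
        intro t
        have := hasDerivAt_mulVec' M w _ t (hw t)
        rwa [Matrix.mulVec_mulVec, hMB, ← Matrix.mulVec_mulVec] at this)
      (by
        intro t
        have := h t
        rw [Multiset.map_cons, Multiset.prod_cons, mul_comm, map_mul, ← Matrix.mulVec_mulVec] at this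
        exact this)
    refine decay_aux_s8 μ (hs μ (Multiset.mem_cons_self _ _)) w _ ?_ hu
    intro t
    have := hw t
    rw [hMw]
    simpa using this

/-- If `0` is a simple root of the characteristic polynomial `p` of `A` and all
other complex eigenvalues of `A` have negative real parts, then for every `b` every solution of
`ẋ = A x + b` satisfies `ẋ(t) → (1/p′(0)) • adj(−A) b` as `t → ∞`. -/
theorem rate_formula_adjugate
    (n : ℕ) (A : Matrix (Fin n) (Fin n) ℝ)
    (hmult : Polynomial.rootMultiplicity 0 A.charpoly = 1)
    (heig : ∀ μ : ℂ, μ ≠ 0 → Polynomial.aeval μ A.charpoly = 0 → μ.re < 0) :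
    ∀ b : Fin n → ℝ, ∀ x : ℝ → Fin n → ℝ,
      (∀ t : ℝ, HasDerivAt x (A.mulVec (x t) + b) t) →
        Tendsto (fun t : ℝ => A.mulVec (x t) + b) atTop
          (nhds ((1 / (Polynomial.derivative A.charpoly).eval 0) •
            (Matrix.adjugate (-A)).mulVec b)) := by
  intro b x hx
  have hp0 : A.charpoly ≠ 0 := (Matrix.charpoly_monic A).ne_zero
  obtain ⟨q, hq, hq0⟩ := Polynomial.exists_eq_pow_rootMultiplicity_mul_and_not_dvd A.charpoly hp0 0
  rw [hmult, pow_one, Polynomial.C_0, sub_zero] at hq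
  rw [Polynomial.dvd_iff_isRoot, Polynomial.IsRoot.def] at hq0
  have hder : (Polynomial.derivative A.charpoly).eval 0 = q.eval 0 := by
    rw [hq]; simp
  rw [adjugate_neg_eq A q hq, hder]
  have hAq : A * Polynomial.aeval A q = 0 := by
    have := Matrix.aeval_self_charpoly A
    rwa [hq, map_mul, Polynomial.aeval_X] at this
  have hqA : Polynomial.aeval A q * A = 0 := by
    have := Matrix.aeval_self_charpoly A
    rwa [hq, mul_comm, map_mul, Polynomial.aeval_X] at this
  set v : ℝ → Fin n → ℝ := fun t => A *ᵥ x t + b with hv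
  have hvd : ∀ t, HasDerivAt v (A *ᵥ v t) t := fun t =>
    (hasDerivAt_mulVec' A x _ t (hx t)).add_const b
  have hqv : ∀ t, Polynomial.aeval A q *ᵥ v t = Polynomial.aeval A q *ᵥ b := by
    intro t
    rw [hv]; simp only
    rw [Matrix.mulVec_add, Matrix.mulVec_mulVec, hqA, Matrix.zero_mulVec, zero_add]
  -- decay of `A v`
  let φ : ℝ →+* ℂ := algebraMap ℝ ℂ
  let B : Matrix (Fin n) (Fin n) ℂ := A.map φ
  let w : ℝ → Fin n → ℂ := fun t i => φ ((A *ᵥ v t) i)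
  have hmv : ∀ (M : Matrix (Fin n) (Fin n) ℝ) (u : Fin n → ℝ),
      (M.map φ) *ᵥ (fun i => φ (u i)) = fun i => φ ((M *ᵥ u) i) := by
    intro M u
    funext i
    exact (RingHom.map_mulVec φ M u i).symm
  have hwd : ∀ t, HasDerivAt w (B *ᵥ w t) t := by
    intro t
    have h1 := hasDerivAt_mulVec' A v _ t (hvd t)
    rw [hmv]
    rw [hasDerivAt_pi] at h1 ⊢
    intro i
    exact (h1 i).ofReal_comp
  have hqne : q ≠ 0 := by rintro rfl; simp at hq0
  have hqmonic : q.Monic := by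
    have := Matrix.charpoly_monic A
    rw [hq] at this
    exact (Polynomial.monic_X.of_mul_monic_left this)
  have hsplit : q.map φ = ((q.map φ).roots.map (fun a => Polynomial.X - Polynomial.C a)).prod := by
    exact (IsAlgClosed.splits (q.map φ)).eq_prod_roots_of_monic (hqmonic.map φ)
  have haev : Polynomial.aeval B (q.map φ) = (Polynomial.aeval A q).map φ := by
    have h1 := Polynomial.map_aeval_eq_aeval_map (S := Matrix (Fin n) (Fin n) ℝ)
      (U := Matrix (Fin n) (Fin n) ℂ) (φ := φ) (ψ := φ.mapMatrix) (by
        ext r i j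
        by_cases h : i = j <;> simp [Matrix.algebraMap_matrix_apply, h]) q A
    exact h1.symm
  have hw0 : Tendsto w atTop (nhds 0) := by
    refine decay_roots B (q.map φ).roots ?_ w hwd ?_
    · intro μ hμ
      have hr := (Polynomial.mem_roots'.1 hμ).2
      rw [Polynomial.IsRoot.def, Polynomial.eval_map] at hr
      have hr' : Polynomial.aeval μ q = 0 := hr
      refine heig μ ?_ ?_
      · rintro rfl
        apply hq0
        have h2 : Polynomial.aeval (algebraMap ℝ ℂ 0) q = 0 := by rwa [map_zero]
        rw [Polynomial.aeval_algebraMap_apply] at h2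
        simpa [Polynomial.coe_aeval_eq_eval] using h2
      · rw [hq, map_mul, hr', mul_zero]
    · intro t
      rw [← hsplit, haev, hmv, Matrix.mulVec_mulVec, hqA]
      funext i; simp
  have hAv : Tendsto (fun t => A *ᵥ v t) atTop (nhds 0) := by
    rw [tendsto_pi_nhds] at hw0 ⊢
    intro i
    have := (Complex.continuous_re.tendsto _).comp (hw0 i)
    simpa [w, φ, Function.comp_def] using this
  have hrep : ∀ t, v t = (1 / q.eval 0) •
      (Polynomial.aeval A q *ᵥ b - Polynomial.aeval A q.divX *ᵥ (A *ᵥ v t)) := by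
    intro t
    have h1 : Polynomial.aeval A q = Polynomial.aeval A q.divX * A + (q.eval 0) • 1 := by
      conv_lhs => rw [← Polynomial.divX_mul_X_add q]
      rw [map_add, map_mul, Polynomial.aeval_X, Polynomial.aeval_C,
        Algebra.algebraMap_eq_smul_one, Polynomial.coeff_zero_eq_eval_zero]
    have h2 := hqv t
    rw [← h2, h1, Matrix.add_mulVec, ← Matrix.mulVec_mulVec, add_sub_cancel_left,
      Matrix.smul_mulVec, Matrix.one_mulVec, smul_smul, one_div, inv_mul_cancel₀ hq0, one_smul]
  have hcont : Continuous (fun u : Fin n → ℝ => (1 / q.eval 0) •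
      (Polynomial.aeval A q *ᵥ b - Polynomial.aeval A q.divX *ᵥ u)) := by
    have : Continuous (fun u : Fin n → ℝ => Polynomial.aeval A q.divX *ᵥ u) :=
      Continuous.matrix_mulVec continuous_const continuous_id
    exact Continuous.const_smul (continuous_const.sub this) (1 / q.eval 0)
  have hfin := (hcont.tendsto 0).comp hAv
  rw [Matrix.mulVec_zero, sub_zero] at hfin
  exact hfin.congr fun t => (hrep t).symm
end

section
/- Let A be a real n×n matrix such that: A = −αI + B for some α > 0 and some entrywise nonnegative matrix B; B is irreducible (for all indices i, j there exists k ≥ 1 with (B^k)ᵢⱼ > 0); and every column of A sums to zero (equivalently, the all-ones row vector satisfies 𝟙ᵀ A = 0). Then for every b ∈ ℝⁿ the affine equation ẋ = A x + b admits a straight-line solution with some rate a, and every solution x satisfies lim_{t → ∞} ‖ẋ(t) − a‖ = 0. -/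
open Matrix Filter

open scoped Matrix.Norms.Operator in
lemma exp_entry_hasSum {n : ℕ} (M : Matrix (Fin n) (Fin n) ℝ) (i j : Fin n) :
    HasSum (fun k : ℕ => ((k.factorial : ℝ)⁻¹) * (M ^ k) i j) (NormedSpace.exp M i j) := by
  have h := NormedSpace.exp_series_hasSum_exp' (𝕂 := ℝ) M
  have h2 := h.mapL (LinearMap.toContinuousLinearMap (Matrix.entryLinearMap ℝ ℝ i j))
  simp only [LinearMap.coe_toContinuousLinearMap', Matrix.entryLinearMap_apply, Matrix.smul_apply, smul_eq_mul] at h2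
  exact h2

open scoped Matrix.Norms.Operator in
lemma exp_entry_deriv {n : ℕ} (A : Matrix (Fin n) (Fin n) ℝ) (i j : Fin n) (s : ℝ) :
    HasDerivAt (fun u : ℝ => NormedSpace.exp (u • A) i j) ((NormedSpace.exp (s • A) * A) i j) s := by
  have h := hasDerivAt_exp_smul_const (𝕂 := ℝ) A s
  have h2 := (LinearMap.toContinuousLinearMap (Matrix.entryLinearMap ℝ ℝ i j)).hasFDerivAt.comp_hasDerivAt s h
  exact h2

lemma pow_entry_nonneg {n : ℕ} {B : Matrix (Fin n) (Fin n) ℝ} (hB : ∀ i j, 0 ≤ B i j) (k : ℕ) :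
    ∀ i j, 0 ≤ (B ^ k) i j := by
  induction k with
  | zero => intro i j; simp only [pow_zero, Matrix.one_apply]; split_ifs <;> norm_num
  | succ k ih =>
    intro i j
    rw [pow_succ, Matrix.mul_apply]
    exact Finset.sum_nonneg fun l _ => mul_nonneg (ih i l) (hB l j)

lemma exp_split {n : ℕ} (A B : Matrix (Fin n) (Fin n) ℝ) (α : ℝ)
    (hAB : A = (-α) • (1 : Matrix (Fin n) (Fin n) ℝ) + B) (i j : Fin n) :
    NormedSpace.exp A i j = Real.exp (-α) * NormedSpace.exp B i j := by
  have h1 : (-α) • (1 : Matrix (Fin n) (Fin n) ℝ) = Matrix.diagonal (fun _ => -α) := by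
    ext i j; simp [Matrix.diagonal_apply, Matrix.one_apply]
  rw [hAB, Matrix.exp_add_of_commute _ _ ((Commute.one_left B).smul_left _), h1,
    Matrix.exp_diagonal, Matrix.diagonal_mul, Pi.coe_exp, Real.exp_eq_exp_ℝ]

lemma exp_nonneg_entry {n : ℕ} (A B : Matrix (Fin n) (Fin n) ℝ) (α : ℝ)
    (hAB : A = (-α) • (1 : Matrix (Fin n) (Fin n) ℝ) + B) (hB : ∀ i j, 0 ≤ B i j)
    (i j : Fin n) : 0 ≤ NormedSpace.exp A i j := by
  rw [exp_split A B α hAB]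
  refine mul_nonneg (Real.exp_pos _).le ((exp_entry_hasSum B i j).nonneg fun k => ?_)
  exact mul_nonneg (by positivity) (pow_entry_nonneg hB k i j)

lemma exp_pos_entry {n : ℕ} (A B : Matrix (Fin n) (Fin n) ℝ) (α : ℝ)
    (hAB : A = (-α) • (1 : Matrix (Fin n) (Fin n) ℝ) + B) (hB : ∀ i j, 0 ≤ B i j)
    (i j : Fin n) (hirr : ∃ k : ℕ, 1 ≤ k ∧ 0 < (B ^ k) i j) : 0 < NormedSpace.exp A i j := by
  rw [exp_split A B α hAB]
  obtain ⟨k, -, hk⟩ := hirr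
  refine mul_pos (Real.exp_pos _) (lt_of_lt_of_le ?_ (le_hasSum (exp_entry_hasSum B i j) k ?_))
  · positivity
  · intro l _
    exact mul_nonneg (by positivity) (pow_entry_nonneg hB l i j)

lemma exp_colsum {n : ℕ} (A : Matrix (Fin n) (Fin n) ℝ) (hcol : ∀ j, ∑ i, A i j = 0) (j : Fin n) :
    ∑ i, NormedSpace.exp A i j = 1 := by
  have h := hasSum_sum (s := Finset.univ) fun i _ => exp_entry_hasSum A i j
  have h0 := hasSum_single (f := fun k : ℕ => ∑ i, ((k.factorial : ℝ)⁻¹) * (A ^ k) i j) 0 (by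
    intro k hk
    obtain ⟨m, rfl⟩ := Nat.exists_eq_succ_of_ne_zero hk
    rw [← Finset.mul_sum]
    simp only [Nat.succ_eq_add_one, pow_succ', Matrix.mul_apply]
    rw [Finset.sum_comm]
    simp [← Finset.sum_mul, hcol])
  rw [h.unique h0]
  simp [Matrix.one_apply]

lemma contract {n : ℕ} (Q : Matrix (Fin n) (Fin n) ℝ) (δ : ℝ) (hQ : ∀ i j, δ ≤ Q i j)
    (hc : ∀ j, ∑ i, Q i j = 1) (v : Fin n → ℝ) (hv : ∑ i, v i = 0) :
    ∑ i, |(Q *ᵥ v) i| ≤ (1 - n * δ) * ∑ i, |v i| := by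
  have h1 : ∀ i, |(Q *ᵥ v) i| ≤ ∑ j, (Q i j - δ) * |v j| := by
    intro i
    have : (Q *ᵥ v) i = ∑ j, (Q i j - δ) * v j := by
      simp [Matrix.mulVec, dotProduct, sub_mul, Finset.sum_sub_distrib, ← Finset.mul_sum, hv]
    rw [this]
    refine (Finset.abs_sum_le_sum_abs _ _).trans (Finset.sum_le_sum fun j _ => ?_)
    rw [abs_mul, abs_of_nonneg (sub_nonneg.2 (hQ i j))]
  refine (Finset.sum_le_sum fun i _ => h1 i).trans ?_
  rw [Finset.sum_comm]
  simp [← Finset.sum_mul, Finset.sum_sub_distrib, hc, Finset.mul_sum]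

lemma flow {n : ℕ} (A : Matrix (Fin n) (Fin n) ℝ) (v : ℝ → Fin n → ℝ)
    (hv : ∀ t, HasDerivAt v (A *ᵥ v t) t) (t s : ℝ) :
    v (t + s) = NormedSpace.exp (s • A) *ᵥ v t := by
  have key : ∀ u, HasDerivAt (fun u : ℝ => NormedSpace.exp (u • (-A)) *ᵥ v (t + u)) 0 u := by
    intro u
    rw [hasDerivAt_pi]
    intro i
    have hs : HasDerivAt (fun u => v (t + u)) (A *ᵥ v (t + u)) u := (hv (t + u)).comp_const_add t u
    rw [hasDerivAt_pi] at hs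
    have h := HasDerivAt.fun_sum (u := Finset.univ) fun j _ => (exp_entry_deriv (-A) i j u).mul (hs j)
    refine h.congr_deriv ?_
    rw [Finset.sum_add_distrib]
    change ((NormedSpace.exp (u • -A) * -A) *ᵥ v (t+u)) i + (NormedSpace.exp (u • -A) *ᵥ (A *ᵥ v (t+u))) i = 0
    rw [Matrix.mulVec_mulVec, ← Pi.add_apply, ← Matrix.add_mulVec]
    simp
  have hc := is_const_of_deriv_eq_zero (fun u => (key u).differentiableAt) (fun u => (key u).deriv) s 0
  simp only [zero_smul, NormedSpace.exp_zero, Matrix.one_mulVec, add_zero] at hc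
  rw [← hc, Matrix.mulVec_mulVec, ← Matrix.exp_add_of_commute]
  · simp
  · simp

/-- Suppose `A = -α I + B` with `α > 0`, `B` entrywise nonnegative and
irreducible, and all columns of `A` sum to zero. Then for every `b` the affine equation
`ẋ = A x + b` admits a straight-line solution with some rate `a`, and every solution `x`
satisfies `‖ẋ(t) − a‖ → 0` as `t → ∞`. -/
theorem metzler_graph_straight_line
    (n : ℕ) (A B : Matrix (Fin n) (Fin n) ℝ) (α : ℝ)
    (hα : 0 < α)
    (hAB : A = (-α) • (1 : Matrix (Fin n) (Fin n) ℝ) + B)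
    (hBnonneg : ∀ i j : Fin n, 0 ≤ B i j)
    (hirr : ∀ i j : Fin n, ∃ k : ℕ, 1 ≤ k ∧ 0 < (B ^ k) i j)
    (hcol : ∀ j : Fin n, ∑ i : Fin n, A i j = 0) :
    ∀ b : Fin n → ℝ, ∃ a c : Fin n → ℝ, IsStraightLineSolution A b a c ∧
      ∀ x : ℝ → Fin n → ℝ, (∀ t : ℝ, HasDerivAt x (A.mulVec (x t) + b) t) →
        Tendsto (fun t : ℝ => ‖(A.mulVec (x t) + b) - a‖) atTop (nhds 0) := by
  intro b
  rcases Nat.eq_zero_or_pos n with rfl | hn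
  · refine ⟨0, 0, fun t => ?_, fun x _ => ?_⟩
    · rw [hasDerivAt_pi]; intro i; exact i.elim0
    · have : ∀ y : Fin 0 → ℝ, ‖y‖ = 0 := fun y => by rw [Subsingleton.elim y 0, norm_zero]
      simp [this]
  have : Nonempty (Fin n) := ⟨⟨0, hn⟩⟩
  have hnR : (0 : ℝ) < n := by exact_mod_cast hn
  have hsumA : ∀ v : Fin n → ℝ, ∑ i, (A *ᵥ v) i = 0 := by
    intro v
    simp only [Matrix.mulVec, dotProduct]
    rw [Finset.sum_comm]
    simp [← Finset.sum_mul, hcol]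
  -- uniform positivity of exp A
  obtain ⟨δ, hδ, hδle⟩ : ∃ δ : ℝ, 0 < δ ∧ ∀ i j, δ ≤ NormedSpace.exp A i j := by
    obtain ⟨p, hp⟩ := Finite.exists_min (fun p : Fin n × Fin n => NormedSpace.exp A p.1 p.2)
    exact ⟨_, exp_pos_entry A B α hAB hBnonneg p.1 p.2 (hirr _ _), fun i j => hp (i, j)⟩
  have hρ1 : 1 - n * δ < 1 := by nlinarith
  have hρ0 : 0 ≤ 1 - n * δ := by
    have h := Finset.sum_le_sum fun i (_ : i ∈ Finset.univ) => hδle i ⟨0, hn⟩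
    rw [exp_colsum A hcol] at h
    simp at h
    linarith
  have hstep1 : ∀ v : ℝ → Fin n → ℝ, (∀ t, HasDerivAt v (A *ᵥ v t) t) → (∀ t, ∑ i, v t i = 0) →
      ∀ t, ∑ i, |v (t + 1) i| ≤ (1 - n * δ) * ∑ i, |v t i| := by
    intro v hv h0 t
    rw [flow A v hv t 1, one_smul]
    exact contract _ δ hδle (exp_colsum A hcol) _ (h0 t)
  have hsteps : ∀ v : ℝ → Fin n → ℝ, (∀ t, HasDerivAt v (A *ᵥ v t) t) → (∀ t, ∑ i, v t i = 0) →
      ∀ t s, 0 ≤ s → ∑ i, |v (t + s) i| ≤ ∑ i, |v t i| := by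
    intro v hv h0 t s hs
    rw [flow A v hv t s]
    have h := contract (NormedSpace.exp (s • A)) 0
      (exp_nonneg_entry (s • A) (s • B) (s * α) (by rw [hAB, smul_add, smul_smul]; simp)
        (fun i j => mul_nonneg hs (hBnonneg i j)))
      (exp_colsum (s • A) (fun j => by simp [← Finset.mul_sum, hcol])) (v t) (h0 t)
    simpa using h
  have hinj : ∀ v : Fin n → ℝ, A *ᵥ v = 0 → ∑ i, v i = 0 → v = 0 := by
    intro v hv h0
    have h := hstep1 (fun _ => v) (fun t => by rw [hv]; exact hasDerivAt_const t v) (fun _ => h0) 0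
    have hN : 0 ≤ ∑ i, |v i| := Finset.sum_nonneg fun i _ => abs_nonneg _
    have h1 : ∑ i, |v i| = 0 := by
      have : 0 < n * δ := by positivity
      nlinarith
    rw [Finset.sum_eq_zero_iff_of_nonneg (fun i _ => abs_nonneg _)] at h1
    funext i
    exact abs_eq_zero.1 (h1 i (Finset.mem_univ i))
  -- kernel vector
  obtain ⟨a0, ha0, hAa0⟩ : ∃ v : Fin n → ℝ, v ≠ 0 ∧ A *ᵥ v = 0 := by
    rw [Matrix.exists_mulVec_eq_zero_iff, ← Matrix.exists_vecMul_eq_zero_iff]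
    refine ⟨fun _ => 1, fun h => ?_, ?_⟩
    · exact one_ne_zero (congrFun h ⟨0, hn⟩)
    · funext j; simp [Matrix.vecMul, dotProduct, hcol]
  have hs0 : ∑ i, a0 i ≠ 0 := fun h => ha0 (hinj a0 hAa0 h)
  obtain ⟨a, hAa, hsa⟩ : ∃ a : Fin n → ℝ, A *ᵥ a = 0 ∧ ∑ i, a i = ∑ i, b i := by
    refine ⟨((∑ i, b i) / ∑ i, a0 i) • a0, by rw [Matrix.mulVec_smul, hAa0, smul_zero], ?_⟩
    simp only [Pi.smul_apply, smul_eq_mul, ← Finset.mul_sum]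
    field_simp
  obtain ⟨c, hc⟩ : ∃ c : Fin n → ℝ, A *ᵥ c = a - b := by
    let σ : (Fin n → ℝ) →ₗ[ℝ] ℝ := ∑ i, LinearMap.proj i
    have hσ : ∀ v, σ v = ∑ i, v i := fun v => by simp [σ]
    let f : LinearMap.ker σ →ₗ[ℝ] LinearMap.ker σ :=
      (A.mulVecLin).restrict (fun v _ => by
        rw [LinearMap.mem_ker, hσ]; exact hsumA v)
    have hf : Function.Injective f := by
      rw [← LinearMap.ker_eq_bot, LinearMap.ker_eq_bot']
      intro m hm
      apply Subtype.ext
      refine hinj m (congrArg Subtype.val hm) ?_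
      rw [← hσ]; exact m.2
    obtain ⟨c, hc⟩ := (LinearMap.injective_iff_surjective.1 hf) ⟨a - b, by
      rw [LinearMap.mem_ker, hσ]; simp [Finset.sum_sub_distrib, hsa]⟩
    exact ⟨c, congrArg Subtype.val hc⟩
  refine ⟨a, c, fun t => ?_, fun x hx => ?_⟩
  · have h : A *ᵥ (t • a + c) + b = (1 : ℝ) • a := by
      rw [Matrix.mulVec_add, Matrix.mulVec_smul, hAa, hc]; simp
    rw [h]
    exact ((hasDerivAt_id t).smul_const a).add_const c
  set v : ℝ → Fin n → ℝ := fun t => A *ᵥ (x t) + b - a with hvdef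
  have hv : ∀ t, HasDerivAt v (A *ᵥ v t) t := by
    intro t
    have h := ((LinearMap.toContinuousLinearMap A.mulVecLin).hasFDerivAt.comp_hasDerivAt t (hx t))
    have h2 := (h.add_const b).sub_const a
    refine h2.congr_deriv ?_
    simp [hvdef, Matrix.mulVec_sub, hAa]
  have hv0 : ∀ t, ∑ i, v t i = 0 := by
    intro t
    simp only [hvdef, Pi.sub_apply, Pi.add_apply, Finset.sum_sub_distrib, Finset.sum_add_distrib,
      hsumA, hsa]
    simp
  have hk : ∀ k : ℕ, ∑ i, |v k i| ≤ (1 - n * δ) ^ k * ∑ i, |v 0 i| := by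
    intro k
    induction k with
    | zero => simp
    | succ k ih =>
      rw [Nat.cast_succ, pow_succ', mul_assoc]
      exact (hstep1 v hv hv0 k).trans (mul_le_mul_of_nonneg_left ih hρ0)
  have hlim : Tendsto (fun t : ℝ => (1 - n * δ) ^ ⌊t⌋₊ * ∑ i, |v 0 i|) atTop (nhds 0) := by
    have h := ((tendsto_pow_atTop_nhds_zero_of_lt_one hρ0 hρ1).comp
      (tendsto_nat_floor_atTop (α := ℝ))).mul_const (∑ i, |v 0 i|)
    simpa [Function.comp_def] using h
  refine squeeze_zero' (Eventually.of_forall fun t => norm_nonneg _) ?_ hlim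
  filter_upwards [eventually_ge_atTop (0 : ℝ)] with t ht
  have h1 := hsteps v hv hv0 (⌊t⌋₊ : ℝ) (t - ⌊t⌋₊) (sub_nonneg.2 (Nat.floor_le ht))
  rw [add_sub_cancel] at h1
  refine le_trans ?_ (h1.trans (hk _))
  rw [pi_norm_le_iff_of_nonneg (Finset.sum_nonneg fun i _ => abs_nonneg _)]
  intro i
  exact Finset.single_le_sum (f := fun i => |v t i|) (fun i _ => abs_nonneg _) (Finset.mem_univ i)
end

section
/- Consider the system ṗ = f(p), q̇ = A q + g(p) on ℝᵐ × ℝⁿ, where A is a real n×n matrix and f has an equilibrium p* (f(p*) = 0). If the algebraic multiplicity of the eigenvalue 0 of A equals the dimension of the kernel of A (equivalently ℝⁿ = im A + ker A), then the full system admits a straight-line solution, namely there exist a ∈ ker A and c ∈ ℝⁿ with a = A c + g(p*) so that t ↦ (p*, t a + c) solves the system. -/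
open Matrix

/-- For the system `ṗ = f(p)`, `q̇ = A q + g(p)` where `f` has an equilibrium
`p*`, if the algebraic multiplicity of the eigenvalue `0` of `A` equals the dimension of the
kernel of `A`, then there exist `a ∈ ker A` and `c` with `a = A c + g(p*)`, so that
`t ↦ (p*, t a + c)` is a straight-line solution of the full system. -/
theorem skew_product_affine_straight_line
    (m n : ℕ)
    (f : (Fin m → ℝ) → (Fin m → ℝ))
    (g : (Fin m → ℝ) → (Fin n → ℝ))
    (A : Matrix (Fin n) (Fin n) ℝ)
    (pstar : Fin m → ℝ)
    (heq : f pstar = 0)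
    (hmult : Polynomial.rootMultiplicity 0 A.charpoly =
      Module.finrank ℝ (LinearMap.ker A.mulVecLin)) :
    ∃ a c : Fin n → ℝ, A.mulVec a = 0 ∧ a = A.mulVec c + g pstar ∧
      ∀ t : ℝ, HasDerivAt
        (fun s : ℝ => ((pstar, s • a + c) : (Fin m → ℝ) × (Fin n → ℝ)))
        (f pstar, A.mulVec (t • a + c) + g pstar) t := by
  set φ : Module.End ℝ (Fin n → ℝ) := A.mulVecLin with hφ
  have hcp : φ.charpoly = A.charpoly := by
    rw [hφ, ← Matrix.toLin'_apply']
    exact Matrix.charpoly_toLin' A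
  have hle : LinearMap.ker φ ≤ φ.maxGenEigenspace 0 := by
    intro x hx
    rw [Module.End.mem_maxGenEigenspace]
    exact ⟨1, by simpa using hx⟩
  have hE : LinearMap.ker φ = φ.maxGenEigenspace 0 := by
    apply Submodule.eq_of_le_of_finrank_eq hle
    rw [LinearMap.finrank_maxGenEigenspace_eq, hcp, hmult]
  have hdis : Disjoint (LinearMap.range φ) (LinearMap.ker φ) := by
    rw [Submodule.disjoint_def]
    rintro x ⟨y, rfl⟩ hy
    have h2 : y ∈ φ.maxGenEigenspace 0 := by
      rw [Module.End.mem_maxGenEigenspace]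
      exact ⟨2, by simpa [pow_two] using hy⟩
    rw [← hE] at h2
    exact h2
  have htop : LinearMap.range φ ⊔ LinearMap.ker φ = ⊤ :=
    Submodule.eq_top_of_disjoint _ _ (LinearMap.finrank_range_add_finrank_ker φ).ge hdis
  have hg : g pstar ∈ LinearMap.range φ ⊔ LinearMap.ker φ := htop ▸ Submodule.mem_top
  obtain ⟨r, ⟨u, hu⟩, k, hk, hrk⟩ := Submodule.mem_sup.1 hg
  have hu' : A.mulVec u = r := hu
  have hk' : A.mulVec k = 0 := hk
  have hac : k = A.mulVec (-u) + g pstar := by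
    rw [Matrix.mulVec_neg, hu', ← hrk]; abel
  refine ⟨k, -u, hk', hac, fun t => ?_⟩
  have h1 : A.mulVec (t • k + -u) + g pstar = k := by
    rw [Matrix.mulVec_add, Matrix.mulVec_smul, hk', smul_zero, zero_add, ← hac]
  rw [h1, heq]
  refine (hasDerivAt_const t pstar).prodMk ?_
  simpa using ((hasDerivAt_id t).smul_const k).add_const (-u)
end
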